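/- arXiv:1310.4127 — 2 statements merged into one kernel-verified Lean document; each statement's English description precedes it below -/
import Mathlib

section
/- Let V_i, V_j be finite sets with |V_i| = r_i and |V_j| = r_j, and let F be a uniformly random subset of V_i × V_j of size f. Then the probability that some u ∈ V_i has degree d(u) = |{v ∈ V_j : (u,v) ∈ F}| outside the interval [f/(2r_i), 2f/r_i] is at most 2·r_i·exp(−f/(8 r_i)). -/
open Finset
open scoped Classical

/-- Deleting `k` elements from the ground set multiplies the number of `f`-subsets by at most
`((N - f) / N) ^ k`. -/
theorem choose_sub_le_mul_pow (N f k : ℕ) (hf : f ≤ N) (hk : k ≤ N) :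
    ((N - k).choose f : ℝ) ≤ N.choose f * (((N : ℝ) - f) / N) ^ k := by
  induction k with
  | zero => simp
  | succ k ih =>
    have hle := ih (by omega)
    obtain ⟨m, rfl⟩ : ∃ m, N = m + 1 + k := ⟨N - (k + 1), by omega⟩
    have e1 : m + 1 + k - (k + 1) = m := by omega
    have e2 : m + 1 + k - k = m + 1 := by omega
    rw [e1]
    rw [e2] at hle
    have hq : (0 : ℝ) ≤ ((m + 1 + k : ℕ) : ℝ) - f := by
      rw [sub_nonneg]; exact_mod_cast hf
    have hp : (0 : ℝ) < ((m + 1 + k : ℕ) : ℝ) := by positivity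
    have step : (m.choose f : ℝ) ≤
        (m + 1).choose f * ((((m + 1 + k : ℕ) : ℝ) - f) / ((m + 1 + k : ℕ) : ℝ)) := by
      by_cases hfm : f ≤ m + 1
      · have h := Nat.choose_mul_succ_eq m f
        have h' : (m.choose f : ℝ) * (m + 1) = (m + 1).choose f * ((m : ℝ) + 1 - f) := by
          have := congrArg (Nat.cast : ℕ → ℝ) h
          rw [Nat.cast_mul, Nat.cast_mul, Nat.cast_sub hfm] at this
          simpa using this
        have h'' : (m.choose f : ℝ) = (m + 1).choose f * (((m : ℝ) + 1 - f) / (m + 1)) := by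
          field_simp
          linarith
        rw [h'']
        refine mul_le_mul_of_nonneg_left ?_ (Nat.cast_nonneg _)
        rw [div_le_div_iff₀ (by positivity) hp]
        push_cast
        have : (0 : ℝ) ≤ (k : ℝ) * f := by positivity
        nlinarith
      · rw [Nat.choose_eq_zero_of_lt (by omega)]
        simp only [Nat.cast_zero]
        positivity
    calc (m.choose f : ℝ) ≤ _ := step
      _ ≤ _ := mul_le_mul_of_nonneg_right hle (by positivity)
      _ = _ := by rw [pow_succ, mul_assoc]

section Hypergeometric

variable {γ : Type*} [DecidableEq γ]

theorem sum_two_pow_card_sdiff_le (S A : Finset γ) (f : ℕ) (hA : A ⊆ S) (hf : f ≤ #S) :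
    ∑ F ∈ S.powersetCard f, (2 : ℝ) ^ #(A \ F) ≤
      (#S).choose f * (1 + ((#S : ℝ) - f) / #S) ^ #A := by
  have h1 : ∀ F : Finset γ, (2 : ℝ) ^ #(A \ F) =
      ∑ B ∈ A.powerset, if Disjoint B F then (1 : ℝ) else 0 := by
    intro F
    have : A.powerset.filter (fun B => Disjoint B F) = (A \ F).powerset := by
      ext B
      simp [subset_sdiff]
    rw [sum_boole, this, card_powerset]
    simp
  have h2 : ∀ B ∈ A.powerset,
      (∑ F ∈ S.powersetCard f, if Disjoint B F then (1 : ℝ) else 0) ≤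
        (#S).choose f * (((#S : ℝ) - f) / #S) ^ #B := by
    intro B hB
    have hBS : B ⊆ S := (mem_powerset.1 hB).trans hA
    have : (S.powersetCard f).filter (fun F => Disjoint B F) = (S \ B).powersetCard f := by
      ext F
      simp only [mem_filter, mem_powersetCard, subset_sdiff, disjoint_comm]
      tauto
    rw [sum_boole, this, card_powersetCard, card_sdiff_of_subset hBS]
    exact choose_sub_le_mul_pow _ _ _ hf (card_le_card hBS)
  simp_rw [h1]
  rw [sum_comm]
  refine (sum_le_sum h2).trans_eq ?_
  rw [← mul_sum, add_comm, ← sum_pow_mul_eq_add_pow]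
  simp

theorem sum_two_pow_card_inter_le (S A : Finset γ) (f : ℕ) (hA : A ⊆ S) (hf : f ≤ #S) :
    ∑ F ∈ S.powersetCard f, (2 : ℝ) ^ #(A ∩ F) ≤
      (#S).choose f * (1 + (f : ℝ) / #S) ^ #A := by
  have h := sum_two_pow_card_sdiff_le S A (#S - f) hA (Nat.sub_le _ _)
  rw [Nat.choose_symm hf, Nat.cast_sub hf, sub_sub_cancel] at h
  refine le_of_eq_of_le ?_ h
  refine sum_nbij' (fun F => S \ F) (fun F => S \ F) ?_ ?_ ?_ ?_ ?_
  · intro F hF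
    rw [mem_powersetCard] at hF ⊢
    exact ⟨sdiff_subset, by rw [card_sdiff_of_subset hF.1, hF.2]⟩
  · intro F hF
    rw [mem_powersetCard] at hF ⊢
    exact ⟨sdiff_subset, by rw [card_sdiff_of_subset hF.1, hF.2]; omega⟩
  · intro F hF
    exact Finset.sdiff_sdiff_eq_self (mem_powersetCard.1 hF).1
  · intro F hF
    exact Finset.sdiff_sdiff_eq_self (mem_powersetCard.1 hF).1
  · intro F hF
    congr 2
    ext x
    have := @hA x
    simp only [mem_inter, mem_sdiff]
    tauto

theorem two_pow_eq_exp (k : ℕ) : (2 : ℝ) ^ k = Real.exp (k * Real.log 2) := by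
  rw [Real.exp_nat_mul, Real.exp_log two_pos]

/-- Markov's inequality for counting, with exponential weights. -/
theorem card_filter_le_of_sum_two_pow_le {ι : Type*} (T : Finset ι) (P : ι → Prop)
    [DecidablePred P] (w : ι → ℕ) (a b c C : ℝ) (hC : 0 ≤ C) (hP : ∀ i ∈ T, P i → a ≤ w i)
    (hsum : ∑ i ∈ T, (2 : ℝ) ^ w i ≤ C * Real.exp b) (hb : b - a * Real.log 2 ≤ c) :
    (#(T.filter P) : ℝ) ≤ C * Real.exp c := by
  have hlog : 0 ≤ Real.log 2 := Real.log_nonneg one_le_two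
  have h : (#(T.filter P) : ℝ) * Real.exp (a * Real.log 2) ≤ C * Real.exp b := by
    refine le_trans ?_ hsum
    rw [← nsmul_eq_mul]
    refine (card_nsmul_le_sum (T.filter P) (fun i => (2 : ℝ) ^ w i) _ ?_).trans
      (sum_le_sum_of_subset_of_nonneg (filter_subset _ _) fun _ _ _ => by positivity)
    intro i hi
    rw [mem_filter] at hi
    rw [two_pow_eq_exp]
    exact Real.exp_le_exp.2 (mul_le_mul_of_nonneg_right (hP i hi.1 hi.2) hlog)
  calc (#(T.filter P) : ℝ) ≤ C * Real.exp b / Real.exp (a * Real.log 2) := by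
        rwa [le_div_iff₀ (Real.exp_pos _)]
    _ = C * Real.exp (b - a * Real.log 2) := by rw [Real.exp_sub, mul_div_assoc]
    _ ≤ _ := by gcongr

theorem card_filter_card_inter_lt_le (S A : Finset γ) (f : ℕ) (hA : A ⊆ S) (hf : f ≤ #S)
    (μ : ℝ) (hμ : μ = #A * (f / #S)) :
    (#((S.powersetCard f).filter (fun F => (#(A ∩ F) : ℝ) < μ / 2)) : ℝ) ≤
      (#S).choose f * Real.exp (-μ / 8) := by
  have hμ0 : 0 ≤ μ := by rw [hμ]; positivity
  have hp : (f : ℝ) / #S ≤ 1 := div_le_one_of_le₀ (by exact_mod_cast hf) (by positivity)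
  refine card_filter_le_of_sum_two_pow_le _ _ (fun F => #(A \ F)) (#A - μ / 2)
    (#A * Real.log 2 - μ / 2) _ _ (by positivity) ?_ ?_ ?_
  · intro F _ hlt
    have : (#(A ∩ F) : ℝ) + #(A \ F) = #A := by exact_mod_cast card_inter_add_card_sdiff A F
    linarith
  · refine (sum_two_pow_card_sdiff_le S A f hA hf).trans ?_
    refine mul_le_mul_of_nonneg_left ?_ (Nat.cast_nonneg _)
    have hq : 1 + ((#S : ℝ) - f) / #S ≤ 2 * Real.exp (-(f / #S / 2)) := by
      have h1 := Real.add_one_le_exp (-((f : ℝ) / #S / 2))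
      have h2 : (#S : ℝ) / #S ≤ 1 := div_self_le_one _
      rw [sub_div]
      linarith
    have hq0 : 0 ≤ 1 + ((#S : ℝ) - f) / #S := by
      have : (0 : ℝ) ≤ (#S : ℝ) - f := sub_nonneg.2 (by exact_mod_cast hf)
      positivity
    refine (pow_le_pow_left₀ hq0 hq _).trans_eq ?_
    rw [mul_pow, two_pow_eq_exp, ← Real.exp_nat_mul, ← Real.exp_add, hμ]
    ring_nf
  · have := Real.log_two_lt_d9
    nlinarith

theorem card_filter_lt_card_inter_le (S A : Finset γ) (f : ℕ) (hA : A ⊆ S) (hf : f ≤ #S)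
    (μ : ℝ) (hμ : μ = #A * (f / #S)) :
    (#((S.powersetCard f).filter (fun F => 2 * μ < (#(A ∩ F) : ℝ))) : ℝ) ≤
      (#S).choose f * Real.exp (-μ / 8) := by
  have hμ0 : 0 ≤ μ := by rw [hμ]; positivity
  refine card_filter_le_of_sum_two_pow_le _ _ (fun F => #(A ∩ F)) (2 * μ) μ _ _
    (by positivity) (fun F _ h => h.le) ?_ ?_
  · refine (sum_two_pow_card_inter_le S A f hA hf).trans ?_
    refine mul_le_mul_of_nonneg_left ?_ (Nat.cast_nonneg _)
    rw [hμ, Real.exp_nat_mul]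
    refine pow_le_pow_left₀ (by positivity) ?_ _
    rw [add_comm]
    exact Real.add_one_le_exp _
  · have := Real.log_two_gt_d9
    nlinarith

end Hypergeometric

/-- For a uniformly random `f`-element subset `F` of `V_i × V_j`, the probability
that some `u ∈ V_i` has degree `d(u) = |{v ∈ V_j : (u,v) ∈ F}|` outside
`[f/(2r_i), 2f/r_i]` is at most `2 r_i exp(-f/(8 r_i))`. -/
theorem stmt_6 {α β : Type*} [DecidableEq α] [DecidableEq β]
    (Vi : Finset α) (Vj : Finset β) (ri rj f : ℕ)
    (hri : Vi.card = ri) (hrj : Vj.card = rj) (hf1 : 1 ≤ f) (hf2 : f ≤ ri * rj) :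
    ((((Vi ×ˢ Vj).powersetCard f).filter (fun F =>
          ∃ u ∈ Vi,
            ¬ ((f : ℝ) / (2 * ri) ≤ ((Vj.filter (fun v => (u, v) ∈ F)).card : ℝ) ∧
               ((Vj.filter (fun v => (u, v) ∈ F)).card : ℝ) ≤ 2 * f / ri))).card : ℝ)
        / (((Vi ×ˢ Vj).powersetCard f).card : ℝ)
      ≤ 2 * ri * Real.exp (-(f : ℝ) / (8 * ri)) := by
  have hS : #(Vi ×ˢ Vj) = ri * rj := by rw [card_product, hri, hrj]
  have hpos : 0 < ri * rj := by omega
  have hri0 : (0 : ℝ) < ri := by exact_mod_cast Nat.pos_of_mul_pos_right hpos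
  have hrj0 : (0 : ℝ) < rj := by exact_mod_cast Nat.pos_of_mul_pos_left hpos
  have hfS : f ≤ #(Vi ×ˢ Vj) := hS ▸ hf2
  have hdeg : ∀ (u : α) (F : Finset (α × β)),
      #(Vj.filter (fun v => (u, v) ∈ F)) = #(({u} ×ˢ Vj) ∩ F) := by
    intro u F
    refine card_bij (fun v _ => (u, v)) (by simp) (by simp) ?_
    rintro ⟨a, v⟩ h
    simp only [mem_inter, mem_product, mem_singleton] at h
    obtain ⟨⟨rfl, hv⟩, hF⟩ := h
    exact ⟨v, mem_filter.2 ⟨hv, hF⟩, rfl⟩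
  have hchoose : (0 : ℝ) < (#(Vi ×ˢ Vj)).choose f := by
    exact_mod_cast Nat.choose_pos hfS
  rw [card_powersetCard, div_le_iff₀ hchoose]
  set low : α → Finset (Finset (α × β)) := fun u =>
    ((Vi ×ˢ Vj).powersetCard f).filter
      (fun F => (#(({u} ×ˢ Vj) ∩ F) : ℝ) < (f : ℝ) / ri / 2)
  set high : α → Finset (Finset (α × β)) := fun u =>
    ((Vi ×ˢ Vj).powersetCard f).filter
      (fun F => 2 * ((f : ℝ) / ri) < (#(({u} ×ˢ Vj) ∩ F) : ℝ))
  have hbad : ∀ u ∈ Vi, (#(low u ∪ high u) : ℝ) ≤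
      2 * ((#(Vi ×ˢ Vj)).choose f * Real.exp (-((f : ℝ) / ri) / 8)) := by
    intro u hu
    have hA : {u} ×ˢ Vj ⊆ Vi ×ˢ Vj :=
      product_subset_product_left (singleton_subset_iff.2 hu)
    have hμ : (f : ℝ) / ri = #({u} ×ˢ Vj) * (f / #(Vi ×ˢ Vj)) := by
      rw [hS, card_product, card_singleton, one_mul, hrj]
      push_cast
      field_simp
    have h1 := card_filter_card_inter_lt_le _ _ f hA hfS _ hμ
    have h2 := card_filter_lt_card_inter_le _ _ f hA hfS _ hμ
    have h3 : (#(low u ∪ high u) : ℝ) ≤ #(low u) + #(high u) := by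
      exact_mod_cast card_union_le _ _
    linarith
  calc _ ≤ (#(Vi.biUnion fun u => low u ∪ high u) : ℝ) := by
        refine Nat.cast_le.2 (card_le_card ?_)
        intro F hF
        obtain ⟨hFS, u, hu, hn⟩ := mem_filter.1 hF
        rw [hdeg, not_and_or, not_le, not_le] at hn
        refine mem_biUnion.2 ⟨u, hu, mem_union.2 (hn.imp ?_ ?_)⟩
        · intro h
          refine mem_filter.2 ⟨hFS, ?_⟩
          rwa [div_div, mul_comm]
        · intro h
          refine mem_filter.2 ⟨hFS, ?_⟩
          rwa [← mul_div_assoc]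
    _ ≤ ∑ u ∈ Vi, (#(low u ∪ high u) : ℝ) := by exact_mod_cast card_biUnion_le
    _ ≤ ∑ _u ∈ Vi, 2 * ((#(Vi ×ˢ Vj)).choose f * Real.exp (-((f : ℝ) / ri) / 8)) :=
        sum_le_sum hbad
    _ = _ := by
        have he : -((f : ℝ) / ri) / 8 = -(f : ℝ) / (8 * ri) := by field_simp
        rw [sum_const, nsmul_eq_mul, hri, he]
        ring
end

section
/- Let V_i, V_j, V_k be finite sets with |V_i| = r_i, |V_j| = r_j, |V_k| = r_k, fix u ∈ V_i, and let F_ij ⊆ V_i × V_j, F_ik ⊆ V_i × V_k, F_jk ⊆ V_j × V_k be independent uniformly random subsets of sizes f_ij, f_ik, f_jk respectively. Define A = {(v,w) ∈ V_j × V_k : (u,v) ∈ F_ij, (u,w) ∈ F_ik, (v,w) ∈ F_jk}. Then Pr[ |A| > 22·f_ij·f_ik·f_jk/(r_i²·r_j·r_k) ] ≤ exp(−f_ij/(3r_i)) + 2·(f_ij/r_i)·( 2^(−11·f_jk·f_ik/(r_i·r_j·r_k)) + exp(−f_jk/(3r_j)) ). -/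
open Finset
open scoped Classical

lemma choose_sub_mul_pow_le {N n : ℕ} (hn : n ≤ N) (j : ℕ) (hj : j ≤ n) :
    (N - j).choose (n - j) * N ^ j ≤ n ^ j * N.choose n := by
  induction j with
  | zero => simp
  | succ j ih =>
    have ih := ih (by omega)
    obtain ⟨m, rfl⟩ : ∃ m, n = j + 1 + m := ⟨n - (j + 1), by omega⟩
    obtain ⟨M, rfl⟩ : ∃ M, N = j + 1 + m + M := ⟨N - (j + 1 + m), by omega⟩
    have e1 : j + 1 + m + M - (j + 1) = m + M := by omega
    have e2 : j + 1 + m - (j + 1) = m := by omega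
    have e3 : j + 1 + m + M - j = m + M + 1 := by omega
    have e4 : j + 1 + m - j = m + 1 := by omega
    rw [e3, e4] at ih
    rw [e1, e2]
    have absorb : (m + M + 1) * (m + M).choose m = (m + M + 1).choose (m + 1) * (m + 1) :=
      Nat.add_one_mul_choose_eq _ _
    have ratio : (m + 1) * (j + 1 + m + M) ≤ (j + 1 + m) * (m + M + 1) := by nlinarith
    refine Nat.le_of_mul_le_mul_left (c := m + M + 1) ?_ (by omega)
    calc (m + M + 1) * ((m + M).choose m * (j + 1 + m + M) ^ (j + 1))
        = ((m + M + 1).choose (m + 1) * (j + 1 + m + M) ^ j) *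
            ((m + 1) * (j + 1 + m + M)) := by
          rw [← mul_assoc, absorb]; ring
      _ ≤ ((j + 1 + m) ^ j * (j + 1 + m + M).choose (j + 1 + m)) *
            ((j + 1 + m) * (m + M + 1)) := Nat.mul_le_mul ih ratio
      _ = _ := by ring

lemma card_powersetCard_filter_superset_mul_pow_le {ι : Type*} [DecidableEq ι] {S J : Finset ι}
    (hJ : J ⊆ S) {n : ℕ} (hn : n ≤ S.card) :
    ((S.powersetCard n).filter (J ⊆ ·)).card * S.card ^ J.card
      ≤ n ^ J.card * (S.powersetCard n).card := by
  rcases lt_or_ge n J.card with h | h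
  · have : (S.powersetCard n).filter (J ⊆ ·) = ∅ := by
      refine filter_eq_empty_iff.2 fun F hF hJF => ?_
      have := card_le_card hJF
      rw [(mem_powersetCard.1 hF).2] at this
      omega
    simp [this]
  · have hsub : (S.powersetCard n).filter (J ⊆ ·) ⊆
        ((S \ J).powersetCard (n - J.card)).image (· ∪ J) := by
      intro F hF
      obtain ⟨hF, hJF⟩ := mem_filter.1 hF
      obtain ⟨hFS, hFc⟩ := mem_powersetCard.1 hF
      refine mem_image.2 ⟨F \ J, mem_powersetCard.2 ⟨sdiff_subset_sdiff hFS le_rfl, ?_⟩,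
        sdiff_union_of_subset hJF⟩
      rw [card_sdiff_of_subset hJF, hFc]
    have hcard := (card_le_card hsub).trans card_image_le
    rw [card_powersetCard, card_sdiff_of_subset hJ] at hcard
    rw [card_powersetCard]
    exact (Nat.mul_le_mul_right _ hcard).trans (choose_sub_mul_pow_le hn _ h)

/-- The exponential moment of a hypergeometric variable is at most that of a Poisson variable of
the same mean. -/
lemma sum_pow_card_inter_le {ι : Type*} [DecidableEq ι] {S T : Finset ι}
    (hT : T ⊆ S) {n : ℕ} (hn : n ≤ S.card) (hS : 0 < S.card) {x : ℝ} (hx : 0 ≤ x) :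
    ∑ F ∈ S.powersetCard n, (1 + x) ^ (F ∩ T).card
      ≤ Real.exp (x * n * T.card / S.card) * (S.powersetCard n).card := by
  have hS' : (0 : ℝ) < S.card := by exact_mod_cast hS
  have expand (A : Finset ι) (y : ℝ) : (1 + y) ^ A.card = ∑ J ∈ A.powerset, y ^ J.card := by
    simpa [add_comm] using Finset.prod_add_one (f := fun _ : ι => y) (s := A)
  calc ∑ F ∈ S.powersetCard n, (1 + x) ^ (F ∩ T).card
      = ∑ F ∈ S.powersetCard n, ∑ J ∈ T.powerset, if J ⊆ F then x ^ J.card else 0 := by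
        refine sum_congr rfl fun F _ => ?_
        rw [expand, ← sum_filter]
        refine sum_congr ?_ fun _ _ => rfl
        ext J
        simp only [mem_powerset, mem_filter, subset_inter_iff, and_comm]
    _ = ∑ J ∈ T.powerset, ((S.powersetCard n).filter (J ⊆ ·)).card * x ^ J.card := by
        rw [sum_comm]
        refine sum_congr rfl fun J _ => ?_
        rw [← sum_filter, sum_const, nsmul_eq_mul]
    _ ≤ ∑ J ∈ T.powerset, (x * n / S.card) ^ J.card * (S.powersetCard n).card := by
        refine sum_le_sum fun J hJ => ?_
        have h := card_powersetCard_filter_superset_mul_pow_le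
          ((mem_powerset.1 hJ).trans hT) hn
        have h' : (((S.powersetCard n).filter (J ⊆ ·)).card : ℝ) * (S.card : ℝ) ^ J.card
            ≤ (n : ℝ) ^ J.card * (S.powersetCard n).card := by exact_mod_cast h
        rw [div_pow, mul_pow, div_mul_eq_mul_div, le_div_iff₀ (by positivity)]
        nlinarith [mul_le_mul_of_nonneg_left h' (pow_nonneg hx J.card)]
    _ = (1 + x * n / S.card) ^ T.card * (S.powersetCard n).card := by
        rw [← sum_mul, expand]
    _ ≤ _ := by
        refine mul_le_mul_of_nonneg_right ?_ (Nat.cast_nonneg _)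
        calc (1 + x * n / S.card) ^ T.card ≤ Real.exp (x * n / S.card) ^ T.card := by
              refine pow_le_pow_left₀ (by positivity) ?_ _
              rw [add_comm]
              exact Real.add_one_le_exp _
          _ = _ := by
              rw [← Real.exp_nat_mul]
              congr 1
              ring

lemma card_filter_lt_card_inter_le_s8 {ι : Type*} [DecidableEq ι] {S T : Finset ι}
    (hT : T ⊆ S) {n : ℕ} (hn : n ≤ S.card) (hS : 0 < S.card) {x : ℝ} (hx : 0 ≤ x) (a : ℝ) :
    (((S.powersetCard n).filter (fun F => a < ((F ∩ T).card : ℝ))).card : ℝ)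
      ≤ Real.exp (x * n * T.card / S.card - a * Real.log (1 + x)) * (S.powersetCard n).card := by
  have hx1 : (0 : ℝ) < 1 + x := by linarith
  have hlog : 0 ≤ Real.log (1 + x) := Real.log_nonneg (by linarith)
  have markov : (((S.powersetCard n).filter (fun F => a < ((F ∩ T).card : ℝ))).card : ℝ) *
      Real.exp (a * Real.log (1 + x)) ≤ ∑ F ∈ S.powersetCard n, (1 + x) ^ (F ∩ T).card := by
    rw [← nsmul_eq_mul, ← sum_const]
    refine (sum_le_sum fun F hF => ?_).trans
      (sum_le_sum_of_subset_of_nonneg (filter_subset _ _) fun _ _ _ => by positivity)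
    rw [← Real.rpow_natCast, Real.rpow_def_of_pos hx1, Real.exp_le_exp, mul_comm]
    exact mul_le_mul_of_nonneg_left (mem_filter.1 hF).2.le hlog
  rw [Real.exp_sub, div_mul_eq_mul_div, le_div_iff₀ (Real.exp_pos _)]
  exact markov.trans (sum_pow_card_inter_le hT hn hS hx)

lemma card_filter_lt_card_row_le {α β : Type*} [DecidableEq α] [DecidableEq β]
    {A : Finset α} {B T : Finset β} {u : α} (hu : u ∈ A) (hT : T ⊆ B) {n : ℕ}
    (hn : n ≤ A.card * B.card) (hpos : 0 < A.card * B.card) {x : ℝ} (hx : 0 ≤ x) (a : ℝ) :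
    ((((A ×ˢ B).powersetCard n).filter
        (fun F => a < ((T.filter (fun w => (u, w) ∈ F)).card : ℝ))).card : ℝ)
      ≤ Real.exp (x * n * T.card / (A.card * B.card) - a * Real.log (1 + x)) *
          ((A ×ˢ B).powersetCard n).card := by
  have hsub : ({u} : Finset α) ×ˢ T ⊆ A ×ˢ B :=
    product_subset_product (singleton_subset_iff.2 hu) hT
  have h := card_filter_lt_card_inter_le_s8 hsub (n := n) (by rwa [card_product])
    (by rwa [card_product]) hx a
  have row (F : Finset (α × β)) :
      (F ∩ ({u} : Finset α) ×ˢ T).card = (T.filter (fun w => (u, w) ∈ F)).card := by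
    rw [← card_image_of_injective (T.filter (fun w => (u, w) ∈ F)) (Prod.mk_right_injective u)]
    congr 1
    ext ⟨a, b⟩
    simp only [mem_inter, mem_product, mem_singleton, mem_image, mem_filter, Prod.mk.injEq]
    constructor
    · rintro ⟨h1, rfl, h2⟩
      exact ⟨b, ⟨h2, h1⟩, rfl, rfl⟩
    · rintro ⟨w, ⟨h2, h1⟩, rfl, rfl⟩
      exact ⟨h1, rfl, h2⟩
  simp only [row, card_product, card_singleton, one_mul, Nat.cast_mul] at h
  exact h

/-- Conditioning bound: if `g` fails outside a proportion `ε` of `s`, and `p a` has density at most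
`δ` whenever `g a` fails, then `p` has density at most `ε + δ`. -/
lemma sum_card_filter_le_of_conditional {A B : Type*} {s : Finset A} {t : Finset B}
    (p : A → B → Prop) (g : A → Prop) [∀ a, DecidablePred (p a)] [DecidablePred g] {ε δ : ℝ} (hδ : 0 ≤ δ)
    (hg : ((s.filter g).card : ℝ) ≤ ε * s.card)
    (hp : ∀ a ∈ s, ¬ g a → ((t.filter (p a)).card : ℝ) ≤ δ * t.card) :
    ∑ a ∈ s, ((t.filter (p a)).card : ℝ) ≤ (ε + δ) * (s.card * t.card) := by
  calc ∑ a ∈ s, ((t.filter (p a)).card : ℝ)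
      ≤ ∑ a ∈ s, ((if g a then (t.card : ℝ) else 0) + δ * t.card) := by
        refine sum_le_sum fun a ha => ?_
        have hle : ((t.filter (p a)).card : ℝ) ≤ t.card := by
          exact_mod_cast card_filter_le _ _
        have hnn : 0 ≤ δ * t.card := by positivity
        split_ifs with h
        · linarith
        · linarith [hp a ha h]
    _ = (s.filter g).card * (t.card : ℝ) + s.card * (δ * t.card) := by
        rw [sum_add_distrib, ← sum_filter, sum_const, sum_const, nsmul_eq_mul, nsmul_eq_mul]
    _ ≤ _ := by
        nlinarith [mul_le_mul_of_nonneg_right hg (Nat.cast_nonneg (α := ℝ) t.card)]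

lemma card_filter_product_eq_sum {A B : Type*} (s : Finset A) (t : Finset B)
    (p : A → B → Prop) [DecidablePred fun q : A × B => p q.1 q.2] [∀ a, DecidablePred (p a)] :
    (((s ×ˢ t).filter (fun q => p q.1 q.2)).card : ℝ)
      = ∑ a ∈ s, ((t.filter (p a)).card : ℝ) := by
  rw [card_filter, sum_product]
  push_cast
  refine sum_congr rfl fun a _ => ?_
  rw [card_filter]
  push_cast
  exact sum_congr rfl fun _ _ => by congr

lemma card_filter_product_eq_sum_right {A B : Type*} (s : Finset A) (t : Finset B)
    (p : A → B → Prop) [DecidablePred fun q : A × B => p q.1 q.2]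
    [∀ b, DecidablePred (p · b)] :
    (((s ×ˢ t).filter (fun q => p q.1 q.2)).card : ℝ)
      = ∑ b ∈ t, ((s.filter (p · b)).card : ℝ) := by
  rw [card_filter, sum_product_right]
  push_cast
  refine sum_congr rfl fun b _ => ?_
  rw [card_filter]
  push_cast
  exact sum_congr rfl fun _ _ => by congr

/-- The hypergeometric degree in a random bipartite graph rarely exceeds twice its mean. -/
lemma card_filter_degree_le {α β : Type*} [DecidableEq α] [DecidableEq β]
    {A : Finset α} {B : Finset β} {u : α} (hu : u ∈ A) {n : ℕ}
    (hn : n ≤ A.card * B.card) (hpos : 0 < A.card * B.card) :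
    ((((A ×ˢ B).powersetCard n).filter
        (fun F => 2 * ((n : ℝ) / A.card) < ((B.filter (fun w => (u, w) ∈ F)).card : ℝ))).card : ℝ)
      ≤ Real.exp (-(n : ℝ) / (3 * A.card)) * ((A ×ˢ B).powersetCard n).card := by
  refine (card_filter_lt_card_row_le hu Subset.rfl hn hpos zero_le_one _).trans ?_
  have hA : (0 : ℝ) < A.card := by exact_mod_cast Nat.pos_of_mul_pos_right hpos
  have hB : (0 : ℝ) < B.card := by exact_mod_cast Nat.pos_of_mul_pos_left hpos
  refine mul_le_mul_of_nonneg_right (Real.exp_le_exp.2 ?_) (Nat.cast_nonneg _)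
  have e1 : 1 * (n : ℝ) * B.card / (A.card * B.card) = n / A.card := by field_simp
  have e2 : -(n : ℝ) / (3 * A.card) = -(1 / 3) * (n / A.card) := by field_simp
  rw [e1, e2, one_add_one_eq_two]
  have : (0 : ℝ) ≤ n / A.card := by positivity
  nlinarith [Real.log_two_gt_d9]

lemma card_filter_codegree_le {α β γ : Type*} [DecidableEq α] [DecidableEq β] [DecidableEq γ]
    {Vi : Finset α} {Vj : Finset β} {Vk : Finset γ} {fik fjk : ℕ} {u : α} {v : β}
    (hu : u ∈ Vi) (hv : v ∈ Vj) (hik : fik ≤ Vi.card * Vk.card) (hjk : fjk ≤ Vj.card * Vk.card)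
    (hk : 0 < Vk.card) :
    (((((Vi ×ˢ Vk).powersetCard fik) ×ˢ ((Vj ×ˢ Vk).powersetCard fjk)).filter (fun q =>
        11 * (fjk : ℝ) * fik / (Vi.card * Vj.card * Vk.card) <
          ((Vk.filter (fun w => (u, w) ∈ q.1 ∧ (v, w) ∈ q.2)).card : ℝ))).card : ℝ)
      ≤ ((2 : ℝ) ^ (-(11 * (fjk : ℝ) * fik / (Vi.card * Vj.card * Vk.card))) +
          Real.exp (-(fjk : ℝ) / (3 * Vj.card))) *
        (((Vi ×ˢ Vk).powersetCard fik) ×ˢ ((Vj ×ˢ Vk).powersetCard fjk)).card := by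
  have hi : 0 < Vi.card := card_pos.2 ⟨u, hu⟩
  have hj : 0 < Vj.card := card_pos.2 ⟨v, hv⟩
  have hi' : (0 : ℝ) < Vi.card := by exact_mod_cast hi
  have hj' : (0 : ℝ) < Vj.card := by exact_mod_cast hj
  have hk' : (0 : ℝ) < Vk.card := by exact_mod_cast hk
  rw [card_filter_product_eq_sum_right _ _ (fun (F : Finset (α × γ)) (G : Finset (β × γ)) =>
    11 * (fjk : ℝ) * fik / (Vi.card * Vj.card * Vk.card) <
      ((Vk.filter (fun w => (u, w) ∈ F ∧ (v, w) ∈ G)).card : ℝ)), card_product, add_comm,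
      Nat.cast_mul, mul_comm (((Vi ×ˢ Vk).powersetCard fik).card : ℝ)]
  refine sum_card_filter_le_of_conditional (fun (G : Finset (β × γ)) (F : Finset (α × γ)) =>
    11 * (fjk : ℝ) * fik / (Vi.card * Vj.card * Vk.card) <
      ((Vk.filter (fun w => (u, w) ∈ F ∧ (v, w) ∈ G)).card : ℝ)) _ (by positivity)
      (card_filter_degree_le hv hjk (Nat.mul_pos hj hk)) fun G _ hG => ?_
  rw [not_lt] at hG
  have key := card_filter_lt_card_row_le hu (filter_subset (fun w => (v, w) ∈ G) Vk) hik
    (Nat.mul_pos hi hk) (zero_le_three (α := ℝ))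
    (11 * (fjk : ℝ) * fik / (Vi.card * Vj.card * Vk.card))
  simp only [filter_filter] at key
  simp only [and_comm (b := (v, _) ∈ G)]
  refine key.trans (mul_le_mul_of_nonneg_right ?_ (Nat.cast_nonneg _))
  rw [Real.rpow_def_of_pos two_pos, Real.exp_le_exp]
  set D : ℝ := ((Vk.filter (fun w => (v, w) ∈ G)).card : ℝ)
  set m : ℝ := (fjk : ℝ) * fik / (Vi.card * Vj.card * Vk.card) with hm
  have hmean : 3 * (fik : ℝ) * D / (Vi.card * Vk.card) ≤ 6 * m := by
    calc 3 * (fik : ℝ) * D / (Vi.card * Vk.card)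
        ≤ 3 * (fik : ℝ) * (2 * (fjk / Vj.card)) / (Vi.card * Vk.card) := by gcongr
      _ = 6 * m := by rw [hm]; field_simp; ring
  have e : 11 * (fjk : ℝ) * fik / (Vi.card * Vj.card * Vk.card) = 11 * m := by
    rw [hm]; ring
  have hlog : Real.log (1 + 3) = 2 * Real.log 2 := by
    rw [← Real.log_rpow two_pos]; norm_num
  have hm0 : 0 ≤ m := by positivity
  rw [e, hlog]
  nlinarith [Real.log_two_gt_d9]

lemma card_filter_product_le_mul {β γ : Type*} {s : Finset β} {t : Finset γ}
    (p : β → Prop) (q : β → γ → Prop) [DecidablePred p] [∀ v, DecidablePred (q v)]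
    [DecidablePred fun vw : β × γ => p vw.1 ∧ q vw.1 vw.2] {a b : ℝ} (hb : 0 ≤ b)
    (ha : ((s.filter p).card : ℝ) ≤ a)
    (hq : ∀ v ∈ s.filter p, ((t.filter (q v)).card : ℝ) ≤ b) :
    (((s ×ˢ t).filter (fun vw => p vw.1 ∧ q vw.1 vw.2)).card : ℝ) ≤ a * b := by
  calc (((s ×ˢ t).filter (fun vw => p vw.1 ∧ q vw.1 vw.2)).card : ℝ)
      = ∑ v ∈ s, ((t.filter (fun w => p v ∧ q v w)).card : ℝ) := by
        convert card_filter_product_eq_sum s t (fun v w => p v ∧ q v w)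
    _ = ∑ v ∈ s.filter p, ((t.filter (q v)).card : ℝ) := by
        rw [sum_filter]
        refine sum_congr rfl fun v _ => ?_
        by_cases h : p v <;> simp [h]
    _ ≤ (s.filter p).card * b := by
        rw [← nsmul_eq_mul]
        exact sum_le_card_nsmul _ _ _ hq
    _ ≤ a * b := mul_le_mul_of_nonneg_right ha hb

/-- For independent uniformly random subsets `F_ij ⊆ V_i × V_j`, `F_ik ⊆ V_i × V_k`,
`F_jk ⊆ V_j × V_k` of sizes `f_ij, f_ik, f_jk` and a fixed `u ∈ V_i`, the set
`A = {(v,w) ∈ V_j × V_k : (u,v) ∈ F_ij, (u,w) ∈ F_ik, (v,w) ∈ F_jk}` satisfies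
`Pr[|A| > 22 f_ij f_ik f_jk / (r_i² r_j r_k)] ≤
  exp(-f_ij/(3r_i)) + 2 (f_ij/r_i) (2^(-11 f_jk f_ik/(r_i r_j r_k)) + exp(-f_jk/(3r_j)))`. -/
theorem stmt_8 {α β γ : Type*} [DecidableEq α] [DecidableEq β] [DecidableEq γ]
    (Vi : Finset α) (Vj : Finset β) (Vk : Finset γ) (ri rj rk fij fik fjk : ℕ)
    (hri : Vi.card = ri) (hrj : Vj.card = rj) (hrk : Vk.card = rk)
    (hfij1 : 1 ≤ fij) (hfij2 : fij ≤ ri * rj)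
    (hfik1 : 1 ≤ fik) (hfik2 : fik ≤ ri * rk)
    (hfjk1 : 1 ≤ fjk) (hfjk2 : fjk ≤ rj * rk)
    (u : α) (hu : u ∈ Vi) :
    (((((Vi ×ˢ Vj).powersetCard fij) ×ˢ ((Vi ×ˢ Vk).powersetCard fik) ×ˢ
          ((Vj ×ˢ Vk).powersetCard fjk)).filter (fun FFF =>
            22 * (fij : ℝ) * fik * fjk / ((ri : ℝ) ^ 2 * rj * rk) <
              (((Vj ×ˢ Vk).filter (fun vw =>
                  (u, vw.1) ∈ FFF.1 ∧ (u, vw.2) ∈ FFF.2.1 ∧ vw ∈ FFF.2.2)).card : ℝ))).card : ℝ)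
        / (((((Vi ×ˢ Vj).powersetCard fij) ×ˢ ((Vi ×ˢ Vk).powersetCard fik) ×ˢ
              ((Vj ×ˢ Vk).powersetCard fjk))).card : ℝ)
      ≤ Real.exp (-(fij : ℝ) / (3 * ri)) +
          2 * ((fij : ℝ) / ri) *
            ((2 : ℝ) ^ (-(11 * (fjk : ℝ) * fik / (ri * rj * rk))) +
              Real.exp (-(fjk : ℝ) / (3 * rj))) := by
  subst hri hrj hrk
  have hi : 0 < Vi.card := card_pos.2 ⟨u, hu⟩
  have hj : 0 < Vj.card := Nat.pos_of_ne_zero fun h => by simp [h] at hfij2; omega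
  have hk : 0 < Vk.card := Nat.pos_of_ne_zero fun h => by simp [h] at hfik2; omega
  set P₁ := (Vi ×ˢ Vj).powersetCard fij
  set P₂ := (Vi ×ˢ Vk).powersetCard fik
  set P₃ := (Vj ×ˢ Vk).powersetCard fjk
  set b : ℝ := 11 * (fjk : ℝ) * fik / (Vi.card * Vj.card * Vk.card) with hb
  set c : ℝ := (2 : ℝ) ^ (-b) + Real.exp (-(fjk : ℝ) / (3 * Vj.card)) with hc
  have hb0 : 0 ≤ b := by positivity
  have hc0 : 0 ≤ c := by positivity
  refine div_le_of_le_mul₀ (Nat.cast_nonneg _) (by positivity) ?_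
  have hthr : 22 * (fij : ℝ) * fik * fjk / ((Vi.card : ℝ) ^ 2 * Vj.card * Vk.card)
      = 2 * ((fij : ℝ) / Vi.card) * b := by
    rw [hb]; field_simp; norm_num
  rw [hthr, card_product, Nat.cast_mul]
  rw [card_filter_product_eq_sum P₁ (P₂ ×ˢ P₃) (fun F q => 2 * ((fij : ℝ) / Vi.card) * b <
    (((Vj ×ˢ Vk).filter (fun vw =>
      (u, vw.1) ∈ F ∧ (u, vw.2) ∈ q.1 ∧ vw ∈ q.2)).card : ℝ))]
  refine sum_card_filter_le_of_conditional _ _ (by positivity)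
    (card_filter_degree_le hu hfij2 (Nat.mul_pos hi hj)) fun F _ hF => ?_
  rw [not_lt] at hF
  set N := Vj.filter (fun v => (u, v) ∈ F) with hN
  have hsub : (P₂ ×ˢ P₃).filter (fun q => 2 * ((fij : ℝ) / Vi.card) * b <
      (((Vj ×ˢ Vk).filter (fun vw =>
        (u, vw.1) ∈ F ∧ (u, vw.2) ∈ q.1 ∧ vw ∈ q.2)).card : ℝ)) ⊆
      N.biUnion fun v => (P₂ ×ˢ P₃).filter (fun q =>
        b < ((Vk.filter (fun w => (u, w) ∈ q.1 ∧ (v, w) ∈ q.2)).card : ℝ)) := by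
    intro q hq
    obtain ⟨hqP, hq⟩ := mem_filter.1 hq
    by_contra hcon
    simp only [mem_biUnion, mem_filter, not_exists, not_and, not_lt] at hcon
    exact absurd hq (not_lt.2 (card_filter_product_le_mul (fun v => (u, v) ∈ F)
      (fun v w => (u, w) ∈ q.1 ∧ (v, w) ∈ q.2) hb0 hF fun v hv => hcon v hv hqP))
  calc _ ≤ ∑ v ∈ N, (((P₂ ×ˢ P₃).filter (fun q =>
        b < ((Vk.filter (fun w => (u, w) ∈ q.1 ∧ (v, w) ∈ q.2)).card : ℝ))).card : ℝ) := by
        exact_mod_cast (card_le_card hsub).trans card_biUnion_le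
    _ ≤ N.card * (c * (P₂ ×ˢ P₃).card) := by
        rw [← nsmul_eq_mul]
        refine sum_le_card_nsmul _ _ _ fun v hv => ?_
        exact card_filter_codegree_le hu (mem_filter.1 hv).1 hfik2 hfjk2 hk
    _ ≤ 2 * ((fij : ℝ) / Vi.card) * (c * (P₂ ×ˢ P₃).card) := by gcongr
    _ = _ := by ring
end
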